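/- Let p be an odd prime and let O be the Hurwitz order in (−1,−1/Q). The number of quaternions α ∈ O with reduced norm p and α ≡ 1 mod 2O equals 2(p + 1). -/

import Mathlib

open scoped Quaternion

/-- The element `a·1 + b·i + c·j + d·ω` of the rational quaternions, where
`ω = (1+i+j+k)/2` is the Hurwitz unit. -/
noncomputable def hurElt (a b c d : ℤ) : ℍ[ℚ] :=
  ⟨(a : ℚ) + (d : ℚ)/2, (b : ℚ) + (d : ℚ)/2, (c : ℚ) + (d : ℚ)/2, (d : ℚ)/2⟩

/-- The Hurwitz order: the `ℤ`-span of `1, i, j, (1+i+j+k)/2` in `(−1,−1/ℚ)`. -/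
def Hur : Set ℍ[ℚ] := {x | ∃ a b c d : ℤ, x = hurElt a b c d}

theorem Int.exists_two_mul_abs_sub_mul_lt {N : ℤ} (hN : 0 < N) (hodd : Odd N) (y : ℤ) :
    ∃ q : ℤ, 2 * |y - N * q| < N := by
  obtain ⟨k, rfl⟩ := hodd
  refine ⟨(y + k) / (2 * k + 1), ?_⟩
  have h1 := Int.emod_add_mul_ediv (y + k) (2 * k + 1)
  have h2 := Int.emod_nonneg (y + k) hN.ne'
  have h3 := Int.emod_lt_of_pos (y + k) hN
  have h4 : |y - (2 * k + 1) * ((y + k) / (2 * k + 1))| ≤ k := by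
    rw [abs_le]; constructor <;> linarith
  linarith

namespace LipschitzQuaternion

theorem normSq_eq (x : ℍ[ℤ]) :
    Quaternion.normSq x = x.re ^ 2 + x.imI ^ 2 + x.imJ ^ 2 + x.imK ^ 2 :=
  Quaternion.normSq_def' x

/-- The Lipschitz quaternion with the given coordinates. -/
def ofCoords (a b c d : ℤ) : ℍ[ℤ] := ⟨a, b, c, d⟩

@[simp] theorem re_ofCoords (a b c d : ℤ) : (ofCoords a b c d).re = a := rfl
@[simp] theorem imI_ofCoords (a b c d : ℤ) : (ofCoords a b c d).imI = b := rfl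
@[simp] theorem imJ_ofCoords (a b c d : ℤ) : (ofCoords a b c d).imJ = c := rfl
@[simp] theorem imK_ofCoords (a b c d : ℤ) : (ofCoords a b c d).imK = d := rfl

theorem normSq_pos {x : ℍ[ℤ]} (hx : x ≠ 0) : 0 < Quaternion.normSq x :=
  lt_of_le_of_ne Quaternion.normSq_nonneg (Ne.symm (Quaternion.normSq_ne_zero.2 hx))

/-- Division with remainder in the Lipschitz quaternions works for divisors of odd norm. -/
theorem exists_normSq_sub_mul_lt {g : ℍ[ℤ]} (hg : Odd (Quaternion.normSq g)) (x : ℍ[ℤ]) :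
    ∃ q : ℍ[ℤ], Quaternion.normSq (x - q * g) < Quaternion.normSq g := by
  have hN : 0 < Quaternion.normSq g := by
    apply normSq_pos
    rintro rfl
    simp at hg
  set N := Quaternion.normSq g with hNdef
  choose f hf using Int.exists_two_mul_abs_sub_mul_lt hN hg
  set y := x * star g with hy
  obtain ⟨q, hq⟩ : ∃ q, q = ofCoords (f y.re) (f y.imI) (f y.imJ) (f y.imK) := ⟨_, rfl⟩
  refine ⟨q, ?_⟩
  have hz : (x - q * g) * star g = y - N • q := by
    rw [sub_mul, mul_assoc, Quaternion.self_mul_star, ← hNdef, Quaternion.mul_coe_eq_smul]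
  have hsq : ∀ t : ℤ, 4 * (t - N * f t) ^ 2 < N ^ 2 := by
    intro t
    have h := hf t
    rw [← sq_abs (t - N * f t)]
    nlinarith [abs_nonneg (t - N * f t)]
  have hnorm : Quaternion.normSq (x - q * g) * N = Quaternion.normSq (y - N • q) := by
    rw [← hz, map_mul, Quaternion.normSq_star]
  rw [normSq_eq (y - N • q)] at hnorm
  simp only [Quaternion.re_sub, Quaternion.imI_sub, Quaternion.imJ_sub, Quaternion.imK_sub,
    Quaternion.re_smul, Quaternion.imI_smul, Quaternion.imJ_smul, Quaternion.imK_smul,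
    smul_eq_mul] at hnorm
  simp only [hq, re_ofCoords, imI_ofCoords, imJ_ofCoords, imK_ofCoords] at hnorm
  have h1 := hsq y.re
  have h2 := hsq y.imI
  have h3 := hsq y.imJ
  have h4 := hsq y.imK
  refine lt_of_mul_lt_mul_right ?_ hN.le
  rw [hq, hnorm]
  nlinarith

/-- An element of odd norm and minimal norm generates a left ideal. -/
theorem exists_eq_mul_of_minimal {L : Ideal ℍ[ℤ]} {g : ℍ[ℤ]} (hgL : g ∈ L)
    (hodd : Odd (Quaternion.normSq g))
    (hmin : ∀ x ∈ L, x ≠ 0 → Quaternion.normSq g ≤ Quaternion.normSq x) {x : ℍ[ℤ]} (hx : x ∈ L) :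
    ∃ q, x = q * g := by
  obtain ⟨q, hq⟩ := exists_normSq_sub_mul_lt hodd x
  refine ⟨q, ?_⟩
  by_contra hne
  exact absurd (hmin _ (L.sub_mem hx (L.mul_mem_left q hgL)) (sub_ne_zero.2 hne)) (not_le.2 hq)

/-- An element of even norm becomes divisible by `2` after left multiplication by some
element of norm `2`. -/
theorem exists_two_mul_eq_mul_of_even {x : ℍ[ℤ]} (hx : Even (Quaternion.normSq x)) :
    ∃ y u : ℍ[ℤ], 2 * y = u * x ∧ Quaternion.normSq x = 2 * Quaternion.normSq y := by
  have hpar : (x.re + x.imI + x.imJ + x.imK) % 2 = 0 := by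
    rw [normSq_eq] at hx
    rw [← Int.even_iff]
    simpa [Int.even_add, Int.even_pow] using hx
  suffices h : ∃ y u : ℍ[ℤ], 2 * y = u * x ∧ Quaternion.normSq u = 2 by
    obtain ⟨y, u, h, hu⟩ := h
    refine ⟨y, u, h, ?_⟩
    have h2 := congrArg Quaternion.normSq h
    rw [map_mul, map_mul, hu, show Quaternion.normSq (2 : ℍ[ℤ]) = 4 from
      (Quaternion.normSq_natCast 2).trans (by norm_num)] at h2
    linarith
  have key : (x.re % 2 = x.imI % 2 ∧ x.imJ % 2 = x.imK % 2) ∨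
      (x.re % 2 = x.imJ % 2 ∧ x.imI % 2 = x.imK % 2) ∨
      (x.re % 2 = x.imK % 2 ∧ x.imI % 2 = x.imJ % 2) := by omega
  rcases key with h | h | h
  · refine ⟨ofCoords ((x.re - x.imI) / 2) ((x.re + x.imI) / 2) ((x.imJ - x.imK) / 2) ((x.imJ + x.imK) / 2),
      ofCoords 1 1 0 0, ?_, by simp [normSq_eq]⟩
    rw [two_mul]
    ext <;> simp <;> omega
  · refine ⟨ofCoords ((x.re - x.imJ) / 2) ((x.imI + x.imK) / 2) ((x.imJ + x.re) / 2) ((x.imK - x.imI) / 2),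
      ofCoords 1 0 1 0, ?_, by simp [normSq_eq]⟩
    rw [two_mul]
    ext <;> simp <;> omega
  · refine ⟨ofCoords ((x.re - x.imK) / 2) ((x.imI - x.imJ) / 2) ((x.imJ + x.imI) / 2) ((x.imK + x.re) / 2),
      ofCoords 1 0 0 1, ?_, by simp [normSq_eq]⟩
    rw [two_mul]
    ext <;> simp <;> omega

/-- The Lipschitz quaternions congruent to `1` modulo twice the Hurwitz order. -/
def Primary (x : ℍ[ℤ]) : Prop :=
  (x.re + x.imI) % 2 = 1 ∧ (x.imI + x.imJ) % 2 = 0 ∧ (x.imI + x.imK) % 2 = 0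

theorem Primary.neg {x : ℍ[ℤ]} (hx : Primary x) : Primary (-x) := by
  simp only [Primary, Quaternion.re_neg, Quaternion.imI_neg, Quaternion.imJ_neg,
    Quaternion.imK_neg] at hx ⊢
  omega

theorem exists_primary_mul {x : ℍ[ℤ]} (hx : Odd (Quaternion.normSq x)) :
    ∃ u : ℍ[ℤ], Quaternion.normSq u = 1 ∧ Primary (u * x) := by
  have hpar : (x.re + x.imI + x.imJ + x.imK) % 2 = 1 := by
    rw [normSq_eq] at hx
    rw [← Int.odd_iff]
    simpa [Int.odd_add, Int.odd_pow, Int.even_pow] using hx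
  have key : ((x.re + x.imI) % 2 = 1 ∧ (x.imI + x.imJ) % 2 = 0 ∧ (x.imI + x.imK) % 2 = 0) ∨
      ((x.re + x.imI) % 2 = 1 ∧ (x.re + x.imJ) % 2 = 0 ∧ (x.re + x.imK) % 2 = 0) ∨
      ((x.re + x.imJ) % 2 = 1 ∧ (x.re + x.imI) % 2 = 0 ∧ (x.re + x.imK) % 2 = 0) ∨
      ((x.re + x.imK) % 2 = 1 ∧ (x.re + x.imI) % 2 = 0 ∧ (x.re + x.imJ) % 2 = 0) := by omega
  rcases key with h | h | h | h
  · exact ⟨1, map_one _, by simpa [Primary] using h⟩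
  · refine ⟨ofCoords 0 1 0 0, by simp [normSq_eq], ?_⟩
    simp [Primary]
    omega
  · refine ⟨ofCoords 0 0 1 0, by simp [normSq_eq], ?_⟩
    simp [Primary]
    omega
  · refine ⟨ofCoords 0 0 0 1, by simp [normSq_eq], ?_⟩
    simp [Primary]
    omega

theorem eq_one_or_eq_neg_one_of_primary_mul {u x : ℍ[ℤ]} (hu : Quaternion.normSq u = 1)
    (hx : Primary x) (hux : Primary (u * x)) : u = 1 ∨ u = -1 := by
  rw [normSq_eq] at hu
  simp only [Primary, Quaternion.re_mul, Quaternion.imI_mul, Quaternion.imJ_mul,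
    Quaternion.imK_mul] at hx hux
  have key : (u.re = 1 ∨ u.re = -1) ∧ u.imI = 0 ∧ u.imJ = 0 ∧ u.imK = 0 := by
    generalize u.re = a at *
    generalize u.imI = b at *
    generalize u.imJ = c at *
    generalize u.imK = d at *
    have ha : -1 ≤ a ∧ a ≤ 1 := by constructor <;> nlinarith
    have hb : -1 ≤ b ∧ b ≤ 1 := by constructor <;> nlinarith
    have hc : -1 ≤ c ∧ c ≤ 1 := by constructor <;> nlinarith
    have hd : -1 ≤ d ∧ d ≤ 1 := by constructor <;> nlinarith
    obtain ⟨ha1, ha2⟩ := ha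
    obtain ⟨hb1, hb2⟩ := hb
    obtain ⟨hc1, hc2⟩ := hc
    obtain ⟨hd1, hd2⟩ := hd
    interval_cases a <;> interval_cases b <;> interval_cases c <;> interval_cases d <;> omega
  obtain ⟨h | h, hi, hj, hk⟩ := key
  · left; ext <;> simp [h, hi, hj, hk]
  · right; ext <;> simp [h, hi, hj, hk]

theorem two_ne_zero_of_odd {p : ℕ} [hp : Fact p.Prime] (h2 : Odd p) : (2 : ZMod p) ≠ 0 := by
  have : Fact (2 < p) := ⟨hp.out.two_le.lt_of_ne fun h ↦ absurd (h ▸ h2) (by decide)⟩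
  exact Ring.two_ne_zero (by rw [ZMod.ringChar_zmod_n]; exact this.out.ne')

section Annihilator

variable {p : ℕ} {a b : ZMod p}

/-- For `a ^ 2 + b ^ 2 = -1` in `ZMod p`, the quaternions whose image under the representation
`i ↦ !![a, b; b, -a]`, `j ↦ !![0, -1; 1, 0]` annihilates the vector `(v, w)`. -/
def annihilator (hab : a ^ 2 + b ^ 2 = -1) (v w : ZMod p) : Ideal ℍ[ℤ] where
  carrier := {x | (x.re + a * x.imI + b * x.imK) * v + (b * x.imI - x.imJ - a * x.imK) * w = 0 ∧
    (b * x.imI + x.imJ - a * x.imK) * v + (x.re - a * x.imI - b * x.imK) * w = 0}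
  zero_mem' := by simp
  add_mem' := by
    rintro x y ⟨h1, h2⟩ ⟨h3, h4⟩
    simp only [Set.mem_ofPred_eq, Quaternion.re_add, Quaternion.imI_add, Quaternion.imJ_add,
      Quaternion.imK_add, Int.cast_add]
    exact ⟨by linear_combination h1 + h3, by linear_combination h2 + h4⟩
  smul_mem' := by
    rintro q x ⟨h1, h2⟩
    simp only [Set.mem_ofPred_eq, smul_eq_mul, Quaternion.re_mul, Quaternion.imI_mul,
      Quaternion.imJ_mul, Quaternion.imK_mul, Int.cast_add, Int.cast_sub, Int.cast_mul]
    constructor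
    · linear_combination (q.re + a * q.imI + b * q.imK) * h1 +
        (b * q.imI - q.imJ - a * q.imK) * h2 -
        ((q.imI * x.imI + q.imK * x.imK) * v + (q.imK * x.imI - q.imI * x.imK) * w) * hab
    · linear_combination (b * q.imI + q.imJ - a * q.imK) * h1 +
        (q.re - a * q.imI - b * q.imK) * h2 -
        ((q.imI * x.imI + q.imK * x.imK) * w - (q.imK * x.imI - q.imI * x.imK) * v) * hab

theorem mem_annihilator {hab : a ^ 2 + b ^ 2 = -1} {v w : ZMod p} {x : ℍ[ℤ]} :
    x ∈ annihilator hab v w ↔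
      (x.re + a * x.imI + b * x.imK) * v + (b * x.imI - x.imJ - a * x.imK) * w = 0 ∧
      (b * x.imI + x.imJ - a * x.imK) * v + (x.re - a * x.imI - b * x.imK) * w = 0 :=
  Iff.rfl

variable [hp : Fact p.Prime] (hab : a ^ 2 + b ^ 2 = -1) {v w : ZMod p}

theorem dvd_normSq_of_mem_annihilator (hvw : v ≠ 0 ∨ w ≠ 0) {x : ℍ[ℤ]}
    (hx : x ∈ annihilator hab v w) : (p : ℤ) ∣ Quaternion.normSq x := by
  rw [← ZMod.intCast_zmod_eq_zero_iff_dvd, normSq_eq]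
  obtain ⟨h1, h2⟩ := mem_annihilator.1 hx
  push_cast
  rcases hvw with h | h <;> refine (mul_eq_zero.1 ?_).resolve_right h
  · linear_combination (x.re - a * x.imI - b * x.imK) * h1 -
      (b * x.imI - x.imJ - a * x.imK) * h2 + (x.imI ^ 2 + x.imK ^ 2) * v * hab
  · linear_combination (x.re + a * x.imI + b * x.imK) * h2 -
      (b * x.imI + x.imJ - a * x.imK) * h1 + (x.imI ^ 2 + x.imK ^ 2) * w * hab

theorem mem_annihilator_of_two_mul_mem (h2 : Odd p) {x : ℍ[ℤ]}
    (hx : 2 * x ∈ annihilator hab v w) : x ∈ annihilator hab v w := by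
  have h20 := two_ne_zero_of_odd h2
  rw [two_mul, mem_annihilator] at hx
  simp only [Quaternion.re_add, Quaternion.imI_add, Quaternion.imJ_add,
      Quaternion.imK_add, Int.cast_add] at hx
  exact mem_annihilator.2 ⟨(mul_eq_zero.1 (by linear_combination hx.1)).resolve_left h20,
    (mul_eq_zero.1 (by linear_combination hx.2)).resolve_left h20⟩

theorem exists_mem_annihilator_normSq_lt (h2 : Odd p) (hvw : v ≠ 0 ∨ w ≠ 0) :
    ∃ x ∈ annihilator hab v w, x ≠ 0 ∧ Quaternion.normSq x < (p : ℤ) ^ 2 := by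
  have hbound : ∀ t : ZMod p, 4 * t.valMinAbs ^ 2 < (p : ℤ) ^ 2 := by
    intro t
    have h := ZMod.natAbs_valMinAbs_le t
    have h' : 2 * |t.valMinAbs| < (p : ℤ) := by
      obtain ⟨k, hk⟩ := h2
      rw [Int.abs_eq_natAbs]
      omega
    rw [← sq_abs]
    nlinarith [abs_nonneg t.valMinAbs]
  refine ⟨ofCoords w.valMinAbs (b * v - a * w).valMinAbs v.valMinAbs (-(b * w) - a * v).valMinAbs,
    ?_, ?_, ?_⟩
  · simp only [mem_annihilator, re_ofCoords, imI_ofCoords, imJ_ofCoords, imK_ofCoords,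
      ZMod.coe_valMinAbs]
    constructor
    · ring
    · linear_combination (v ^ 2 + w ^ 2) * hab
  · intro h
    have hw : w.valMinAbs = 0 := congrArg QuaternionAlgebra.re h
    have hv : v.valMinAbs = 0 := congrArg QuaternionAlgebra.imJ h
    rw [ZMod.valMinAbs_eq_zero] at hw hv
    exact hvw.elim (· hv) (· hw)
  · rw [normSq_eq, re_ofCoords, imI_ofCoords, imJ_ofCoords, imK_ofCoords]
    linarith [hbound w, hbound (b * v - a * w), hbound v, hbound (-(b * w) - a * v)]

theorem le_normSq_of_mem_annihilator (hvw : v ≠ 0 ∨ w ≠ 0) {x : ℍ[ℤ]}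
    (hx : x ∈ annihilator hab v w) (hx0 : x ≠ 0) : (p : ℤ) ≤ Quaternion.normSq x :=
  Int.le_of_dvd (normSq_pos hx0) (dvd_normSq_of_mem_annihilator hab hvw hx)

theorem exists_mem_annihilator_normSq_eq (h2 : Odd p) (hvw : v ≠ 0 ∨ w ≠ 0) :
    ∃ x ∈ annihilator hab v w, Quaternion.normSq x = p := by
  obtain ⟨x, hx, hx0, hxp⟩ := exists_mem_annihilator_normSq_lt hab h2 hvw
  obtain ⟨g, ⟨hg, hg0⟩, hmin⟩ :=
    (measure fun z : ℍ[ℤ] ↦ (Quaternion.normSq z).natAbs).wf.has_min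
      {z | z ∈ annihilator hab v w ∧ z ≠ 0} ⟨x, hx, hx0⟩
  replace hmin : ∀ z ∈ annihilator hab v w, z ≠ 0 →
      Quaternion.normSq g ≤ Quaternion.normSq z := by
    intro z hz hz0
    have h : ¬ (Quaternion.normSq z).natAbs < (Quaternion.normSq g).natAbs := hmin z ⟨hz, hz0⟩
    have := normSq_pos hz0
    have := normSq_pos hg0
    omega
  have hpos := normSq_pos hg0
  have hodd : Odd (Quaternion.normSq g) := by
    by_contra h
    obtain ⟨y, u, hyu, hy⟩ := exists_two_mul_eq_mul_of_even (Int.not_odd_iff_even.1 h)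
    have hyL := mem_annihilator_of_two_mul_mem hab h2 (hyu ▸ Ideal.mul_mem_left _ u hg)
    have hy0 : y ≠ 0 := by
      rintro rfl
      rw [map_zero] at hy
      omega
    have := hmin y hyL hy0
    omega
  have hpL : (p : ℍ[ℤ]) ∈ annihilator hab v w := by
    simp [mem_annihilator]
  obtain ⟨q, hq⟩ := exists_eq_mul_of_minimal hg hodd hmin hpL
  have hdvd : Quaternion.normSq g ∣ (p : ℤ) ^ 2 := by
    refine ⟨Quaternion.normSq q, ?_⟩
    rw [← Quaternion.normSq_natCast, hq, map_mul, mul_comm]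
  have hpdvd := dvd_normSq_of_mem_annihilator hab hvw hg
  have hlt := (hmin x hx hx0).trans_lt hxp
  refine ⟨g, hg, ?_⟩
  obtain ⟨n, hn⟩ := Int.eq_ofNat_of_zero_le hpos.le
  rw [hn] at hdvd hpdvd hlt ⊢
  norm_cast at hdvd hpdvd hlt ⊢
  obtain ⟨i, hi, rfl⟩ := (Nat.dvd_prime_pow hp.out).1 hdvd
  interval_cases i
  · exact absurd (Nat.dvd_one.1 (by simpa using hpdvd)) hp.out.one_lt.ne'
  · exact pow_one p
  · exact absurd hlt (lt_irrefl _)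

theorem exists_primary_mem_annihilator (h2 : Odd p) (hvw : v ≠ 0 ∨ w ≠ 0) :
    ∃ x ∈ annihilator hab v w, Quaternion.normSq x = p ∧ Primary x := by
  obtain ⟨x, hx, hxp⟩ := exists_mem_annihilator_normSq_eq hab h2 hvw
  obtain ⟨u, hu, hux⟩ := exists_primary_mul (x := x) (by rw [hxp]; exact_mod_cast h2)
  exact ⟨u * x, Ideal.mul_mem_left _ u hx, by rw [map_mul, hu, one_mul, hxp], hux⟩

theorem sq_dvd_normSq_of_mem_annihilator_of_mem_annihilator (h2 : Odd p) {v' w' : ZMod p}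
    (hdet : v * w' - v' * w ≠ 0) {x : ℍ[ℤ]} (hx : x ∈ annihilator hab v w)
    (hx' : x ∈ annihilator hab v' w') : (p : ℤ) ^ 2 ∣ Quaternion.normSq x := by
  have h20 := two_ne_zero_of_odd h2
  obtain ⟨h1, h3⟩ := mem_annihilator.1 hx
  obtain ⟨h1', h3'⟩ := mem_annihilator.1 hx'
  have m11 : (x.re + a * x.imI + b * x.imK : ZMod p) = 0 :=
    (mul_eq_zero.1 (by linear_combination w' * h1 - w * h1')).resolve_left hdet
  have m12 : (b * x.imI - x.imJ - a * x.imK : ZMod p) = 0 :=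
    (mul_eq_zero.1 (by linear_combination v * h1' - v' * h1)).resolve_left hdet
  have m21 : (b * x.imI + x.imJ - a * x.imK : ZMod p) = 0 :=
    (mul_eq_zero.1 (by linear_combination w' * h3 - w * h3')).resolve_left hdet
  have m22 : (x.re - a * x.imI - b * x.imK : ZMod p) = 0 :=
    (mul_eq_zero.1 (by linear_combination v * h3' - v' * h3)).resolve_left hdet
  have hre : (x.re : ZMod p) = 0 :=
    (mul_eq_zero.1 (by linear_combination m11 + m22)).resolve_left h20
  have hJ : (x.imJ : ZMod p) = 0 :=
    (mul_eq_zero.1 (by linear_combination m21 - m12)).resolve_left h20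
  have hI : (x.imI : ZMod p) = 0 := by
    linear_combination -a * m11 - b * m12 + a * hre - b * hJ + x.imI * hab
  have hK : (x.imK : ZMod p) = 0 := by
    linear_combination -b * m11 + a * m12 + b * hre + a * hJ + x.imK * hab
  rw [ZMod.intCast_zmod_eq_zero_iff_dvd] at hre hI hJ hK
  rw [normSq_eq]
  exact dvd_add (dvd_add (dvd_add (pow_dvd_pow_of_dvd hre 2) (pow_dvd_pow_of_dvd hI 2))
    (pow_dvd_pow_of_dvd hJ 2)) (pow_dvd_pow_of_dvd hK 2)

/-- A quaternion of norm divisible by `p` annihilates some line in `ZMod p × ZMod p`. -/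
theorem exists_mem_annihilator {x : ℍ[ℤ]} (hx : (p : ℤ) ∣ Quaternion.normSq x) :
    x ∈ annihilator hab 1 0 ∨ ∃ t, x ∈ annihilator hab t 1 := by
  rw [← ZMod.intCast_zmod_eq_zero_iff_dvd, normSq_eq] at hx
  push_cast at hx
  have hdet : (x.re + a * x.imI + b * x.imK) * (x.re - a * x.imI - b * x.imK) -
      (b * x.imI - x.imJ - a * x.imK) * (b * x.imI + x.imJ - a * x.imK) = (0 : ZMod p) := by
    linear_combination hx - (x.imI ^ 2 + x.imK ^ 2) * hab
  simp only [mem_annihilator]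
  generalize (x.re + a * x.imI + b * x.imK : ZMod p) = m11 at *
  generalize (b * x.imI - x.imJ - a * x.imK : ZMod p) = m12 at *
  generalize (b * x.imI + x.imJ - a * x.imK : ZMod p) = m21 at *
  generalize (x.re - a * x.imI - b * x.imK : ZMod p) = m22 at *
  by_cases h11 : m11 = 0
  · by_cases h21 : m21 = 0
    · left; simp [h11, h21]
    · right
      refine ⟨-m22 / m21, ?_, ?_⟩ <;> field_simp
      · linear_combination -hdet
      · ring
  · right
    refine ⟨-m12 / m11, ?_, ?_⟩ <;> field_simp
    · ring
    · linear_combination hdet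

theorem eq_or_eq_neg_of_mem_annihilator (h2 : Odd p) (hvw : v ≠ 0 ∨ w ≠ 0) {x y : ℍ[ℤ]}
    (hx : x ∈ annihilator hab v w) (hy : y ∈ annihilator hab v w)
    (hxp : Quaternion.normSq x = p) (hyp : Quaternion.normSq y = p)
    (hxP : Primary x) (hyP : Primary y) : y = x ∨ y = -x := by
  have hp0 : (p : ℤ) ≠ 0 := mod_cast hp.out.ne_zero
  obtain ⟨q, rfl⟩ := exists_eq_mul_of_minimal hx (by rw [hxp]; exact_mod_cast h2)
    (fun z hz hz0 ↦ hxp ▸ le_normSq_of_mem_annihilator hab hvw hz hz0) hy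
  have hq : Quaternion.normSq q = 1 := by
    rw [map_mul, hxp] at hyp
    exact mul_right_cancel₀ hp0 (by rw [hyp, one_mul])
  rcases eq_one_or_eq_neg_one_of_primary_mul hq hxP hyP with rfl | rfl <;> simp

end Annihilator

theorem card_primary {p : ℕ} (hp : p.Prime) (h2 : Odd p) :
    Nat.card {x : ℍ[ℤ] // Quaternion.normSq x = p ∧ Primary x} = 2 * (p + 1) := by
  have : Fact p.Prime := ⟨hp⟩
  obtain ⟨a, b, hab⟩ := ZMod.sq_add_sq p (-1)
  let L : Option (ZMod p) → Ideal ℍ[ℤ] := fun t ↦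
    t.elim (annihilator hab 1 0) (fun t ↦ annihilator hab t 1)
  have hex : ∀ t, ∃ x ∈ L t, Quaternion.normSq x = p ∧ Primary x := by
    rintro (_ | t)
    · exact exists_primary_mem_annihilator hab h2 (Or.inl one_ne_zero)
    · exact exists_primary_mem_annihilator hab h2 (Or.inr one_ne_zero)
  have huniq : ∀ t, ∀ x ∈ L t, ∀ y ∈ L t, Quaternion.normSq x = p → Quaternion.normSq y = p →
      Primary x → Primary y → y = x ∨ y = -x := by
    rintro (_ | t) x hx y hy
    · exact eq_or_eq_neg_of_mem_annihilator hab h2 (Or.inl one_ne_zero) hx hy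
    · exact eq_or_eq_neg_of_mem_annihilator hab h2 (Or.inr one_ne_zero) hx hy
  have hdisj : ∀ t t' x, x ∈ L t → x ∈ L t' → Quaternion.normSq x = p → t = t' := by
    intro t t' x hx hx' hxp
    have hndvd : ¬ (p : ℤ) ^ 2 ∣ Quaternion.normSq x := by
      rw [hxp]
      norm_cast
      intro h
      have := Nat.le_of_dvd hp.pos h
      nlinarith [hp.one_lt]
    have hdet := fun (v w v' w' : ZMod p) (hv : x ∈ annihilator hab v w)
      (hv' : x ∈ annihilator hab v' w') ↦ not_imp_comm.1
      (sq_dvd_normSq_of_mem_annihilator_of_mem_annihilator hab h2 · hv hv') hndvd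
    rcases t with _ | t <;> rcases t' with _ | t'
    · rfl
    · exact absurd (hdet 1 0 t' 1 hx hx') (by simp)
    · exact absurd (hdet t 1 1 0 hx hx') (by simp)
    · have := hdet t 1 t' 1 hx hx'
      rw [mul_one, mul_one, sub_eq_zero] at this
      rw [this]
  choose f hfL hfp hfP using hex
  let F : Option (ZMod p) × Bool → {x : ℍ[ℤ] // Quaternion.normSq x = p ∧ Primary x} :=
    fun s ↦ bif s.2 then ⟨f s.1, hfp s.1, hfP s.1⟩
      else ⟨-f s.1, by rw [Quaternion.normSq_neg, hfp], (hfP s.1).neg⟩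
  have hFL : ∀ s, (F s : ℍ[ℤ]) ∈ L s.1 := by
    rintro ⟨t, _ | _⟩
    · exact neg_mem (hfL t)
    · exact hfL t
  have hne : ∀ t, f t ≠ -f t := by
    intro t h
    have h1 := (hfP t).1
    have hre := congrArg QuaternionAlgebra.re h
    have hI := congrArg QuaternionAlgebra.imI h
    rw [Quaternion.re_neg] at hre
    rw [Quaternion.imI_neg] at hI
    omega
  have hF : Function.Bijective F := by
    constructor
    · rintro ⟨t, e⟩ ⟨t', e'⟩ h
      obtain rfl : t = t' := hdisj t t' _ (hFL (t, e)) (h ▸ hFL (t', e')) (F (t, e)).2.1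
      replace h := congrArg Subtype.val h
      cases e <;> cases e'
      · rfl
      · exact absurd h.symm (hne t)
      · exact absurd h (hne t)
      · rfl
    · rintro ⟨x, hxp, hxP⟩
      obtain ⟨t, ht⟩ : ∃ t, x ∈ L t := by
        rcases exists_mem_annihilator hab (dvd_of_eq hxp.symm) with h | ⟨t, h⟩
        · exact ⟨none, h⟩
        · exact ⟨some t, h⟩
      rcases huniq t _ (hfL t) x ht (hfp t) hxp (hfP t) hxP with h | h
      · exact ⟨(t, true), Subtype.ext h.symm⟩
      · exact ⟨(t, false), Subtype.ext h.symm⟩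
  rw [← Nat.card_eq_of_bijective F hF, Nat.card_prod, Nat.card_eq_fintype_card (α := Bool),
    Fintype.card_bool, Finite.card_option, Nat.card_zmod, mul_comm]

/-- The inclusion of the Lipschitz quaternions into the rational quaternions. -/
def toRat (x : ℍ[ℤ]) : ℍ[ℚ] := ⟨x.re, x.imI, x.imJ, x.imK⟩

@[simp] theorem re_toRat (x : ℍ[ℤ]) : (toRat x).re = x.re := rfl
@[simp] theorem imI_toRat (x : ℍ[ℤ]) : (toRat x).imI = x.imI := rfl
@[simp] theorem imJ_toRat (x : ℍ[ℤ]) : (toRat x).imJ = x.imJ := rfl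
@[simp] theorem imK_toRat (x : ℍ[ℤ]) : (toRat x).imK = x.imK := rfl

theorem toRat_injective : Function.Injective toRat := by
  intro x y h
  ext
  · exact Int.cast_injective (congrArg QuaternionAlgebra.re h)
  · exact Int.cast_injective (congrArg QuaternionAlgebra.imI h)
  · exact Int.cast_injective (congrArg QuaternionAlgebra.imJ h)
  · exact Int.cast_injective (congrArg QuaternionAlgebra.imK h)

theorem normSq_toRat (x : ℍ[ℤ]) : Quaternion.normSq (toRat x) = (Quaternion.normSq x : ℤ) := by
  rw [normSq_eq, Quaternion.normSq_def']
  simp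

end LipschitzQuaternion

@[simp] theorem re_hurElt (a b c d : ℤ) : (hurElt a b c d).re = a + (d : ℚ) / 2 := rfl
@[simp] theorem imI_hurElt (a b c d : ℤ) : (hurElt a b c d).imI = b + (d : ℚ) / 2 := rfl
@[simp] theorem imJ_hurElt (a b c d : ℤ) : (hurElt a b c d).imJ = c + (d : ℚ) / 2 := rfl
@[simp] theorem imK_hurElt (a b c d : ℤ) : (hurElt a b c d).imK = (d : ℚ) / 2 := rfl

open LipschitzQuaternion

theorem toRat_mem_hur (x : ℍ[ℤ]) : toRat x ∈ Hur := by
  refine ⟨x.re - x.imK, x.imI - x.imK, x.imJ - x.imK, 2 * x.imK, ?_⟩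
  ext <;> simp

theorem exists_toRat_sub_one_eq {x : ℍ[ℤ]} (hx : Primary x) :
    ∃ w ∈ Hur, toRat x - 1 = 2 * w := by
  obtain ⟨h1, h2, h3⟩ := hx
  obtain ⟨a, ha⟩ : ∃ a, x.re = 1 + 2 * a + x.imK := ⟨(x.re - 1 - x.imK) / 2, by omega⟩
  obtain ⟨b, hb⟩ : ∃ b, x.imI = 2 * b + x.imK := ⟨(x.imI - x.imK) / 2, by omega⟩
  obtain ⟨c, hc⟩ : ∃ c, x.imJ = 2 * c + x.imK := ⟨(x.imJ - x.imK) / 2, by omega⟩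
  refine ⟨_, ⟨a, b, c, x.imK, rfl⟩, ?_⟩
  rw [two_mul]
  ext <;> simp [ha, hb, hc] <;> ring

theorem exists_primary_toRat_eq {y w : ℍ[ℚ]} (hw : w ∈ Hur) (h : y - 1 = 2 * w) :
    ∃ x, Primary x ∧ toRat x = y := by
  obtain ⟨a, b, c, d, rfl⟩ := hw
  rw [sub_eq_iff_eq_add, two_mul] at h
  subst h
  refine ⟨ofCoords (1 + 2 * a + d) (2 * b + d) (2 * c + d) d, ?_, ?_⟩
  · simp only [Primary, re_ofCoords, imI_ofCoords, imJ_ofCoords, imK_ofCoords]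
    omega
  · ext <;> simp <;> ring

/-- For an odd prime `p`, the number of Hurwitz quaternions of reduced norm `p`
congruent to `1` mod `2O` equals `2(p + 1)`. -/
theorem stmt_10 (p : ℕ) (hp : p.Prime) (hodd : Odd p) :
    Nat.card {α : ℍ[ℚ] // α ∈ Hur ∧ Quaternion.normSq α = (p : ℚ) ∧
        ∃ w ∈ Hur, α - 1 = 2 * w} = 2 * (p + 1) := by
  rw [← card_primary hp hodd]
  symm
  refine Nat.card_eq_of_bijective
    (fun x ↦ ⟨toRat x.1, toRat_mem_hur _, by rw [normSq_toRat, x.2.1, Int.cast_natCast],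
      exists_toRat_sub_one_eq x.2.2⟩) ⟨?_, ?_⟩
  · intro x y h
    exact Subtype.ext (toRat_injective (congrArg Subtype.val h))
  · rintro ⟨y, -, hy, w, hw, h⟩
    obtain ⟨x, hx, rfl⟩ := exists_primary_toRat_eq hw h
    rw [normSq_toRat] at hy
    exact ⟨⟨x, by exact_mod_cast hy, hx⟩, rfl⟩
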